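/- arXiv:2501.01927 — 2 statements merged into one kernel-verified Lean document; each statement's English description precedes it below -/
import Mathlib

section
/- Let $n \ge 3$, $\mu \in (0, n)$, $p = \frac{2n-\mu}{n-2}$, and fix $\varepsilon > 0$. Let $W_i = W[\xi_i, \lambda_i]$, $W_j = W[\xi_j, \lambda_j]$ be two standard bubbles, and define the interaction quantity $Q_{ij} = \left(\frac{\lambda_i}{\lambda_j} + \frac{\lambda_j}{\lambda_i} + \lambda_i \lambda_j |\xi_i - \xi_j|^2\right)^{-(n-2)/2}$. Then for nonnegative exponents $\tilde s + \tilde t = 2^* = \frac{2n}{n-2}$ with $|\tilde s - \tilde t| \ge \varepsilon$, one has $\int_{\mathbb{R}^n} W_i^{\tilde s} W_j^{\tilde t}\, dx \approx Q_{ij}^{\min(\tilde s, \tilde t)}$, i.e. the integral is bounded above and below by constant multiples of $Q_{ij}^{\min(\tilde s, \tilde t)}$ with constants depending only on $n, \varepsilon$; if $\tilde s = \tilde t = \frac{n}{n-2}$, then $\int W_i^{\tilde s} W_j^{\tilde t} \approx Q_{ij}^{n/(n-2)} \log(1/Q_{ij})$ (for $Q_{ij}$ small). -/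
open Real MeasureTheory

/-- The standard bubble profile `W[ξ,λ]` with normalization constant `α`. -/
noncomputable def bubble (n : ℕ) (α lam : ℝ) (ξ x : EuclideanSpace ℝ (Fin n)) : ℝ :=
  α * (lam / (1 + lam ^ 2 * ‖x - ξ‖ ^ 2)) ^ (((n : ℝ) - 2) / 2)

/-- The interaction quantity `Q_{ij}` of two bubbles. -/
noncomputable def bubbleQ (n : ℕ) (li lj : ℝ) (ξi ξj : EuclideanSpace ℝ (Fin n)) : ℝ :=
  (li / lj + lj / li + li * lj * ‖ξi - ξj‖ ^ 2) ^ (-(((n : ℝ) - 2) / 2))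

/-- A radial function with integral proportional to `1 / η` on `ℝⁿ`. -/
noncomputable def radialMajorant (n : ℕ) (η y : ℝ) : ℝ :=
  if y ≤ 1 then y ^ (η - n) else y ^ (-(n + η))

lemma radialMajorant_nonneg (n : ℕ) (η : ℝ) {y : ℝ} (hy : 0 ≤ y) : 0 ≤ radialMajorant n η y := by
  unfold radialMajorant
  split_ifs <;> positivity

lemma natPow_pred_mul_rpow {n : ℕ} (hn : 1 ≤ n) {y : ℝ} (hy : 0 < y) (z : ℝ) :
    y ^ (n - 1) * y ^ z = y ^ (z + n - 1) := by
  rw [← rpow_natCast, ← rpow_add hy, Nat.cast_sub hn]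
  congr 1
  push_cast
  ring

lemma hasIntegral_radialMajorant {n : ℕ} (hn : 1 ≤ n) {η : ℝ} (hη : 0 < η) :
    IntegrableOn (fun y : ℝ ↦ y ^ (n - 1) • radialMajorant n η y) (Set.Ioi 0) ∧
      ∫ y in Set.Ioi (0 : ℝ), y ^ (n - 1) • radialMajorant n η y = 2 / η := by
  have hinner : Set.EqOn (fun y : ℝ ↦ y ^ (n - 1) • radialMajorant n η y)
      (fun y ↦ y ^ (η - 1)) (Set.Ioc 0 1) := by
    intro y hy
    simp only [radialMajorant, if_pos hy.2, smul_eq_mul]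
    rw [natPow_pred_mul_rpow hn hy.1]
    congr 1
    ring
  have houter : Set.EqOn (fun y : ℝ ↦ y ^ (n - 1) • radialMajorant n η y)
      (fun y ↦ y ^ (-1 - η)) (Set.Ioi 1) := by
    intro y hy
    have hy1 : 1 < y := hy
    simp only [radialMajorant, if_neg hy1.not_ge, smul_eq_mul]
    rw [natPow_pred_mul_rpow hn (by linarith)]
    congr 1
    ring
  have hinner_int : IntegrableOn (fun y : ℝ ↦ y ^ (n - 1) • radialMajorant n η y)
      (Set.Ioc 0 1) := by
    rw [integrableOn_congr_fun hinner measurableSet_Ioc,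
      ← intervalIntegrable_iff_integrableOn_Ioc_of_le zero_le_one]
    exact intervalIntegral.intervalIntegrable_rpow' (by linarith)
  have houter_int : IntegrableOn (fun y : ℝ ↦ y ^ (n - 1) • radialMajorant n η y)
      (Set.Ioi 1) := by
    rw [integrableOn_congr_fun houter measurableSet_Ioi]
    exact integrableOn_Ioi_rpow_of_lt (by linarith) one_pos
  rw [← Set.Ioc_union_Ioi_eq_Ioi (zero_le_one' ℝ)]
  refine ⟨hinner_int.union houter_int, ?_⟩
  rw [setIntegral_union (Set.Ioc_disjoint_Ioi le_rfl) measurableSet_Ioi hinner_int houter_int,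
    setIntegral_congr_fun measurableSet_Ioc hinner, setIntegral_congr_fun measurableSet_Ioi houter,
    ← intervalIntegral.integral_of_le zero_le_one, integral_rpow (Or.inl (by linarith)),
    integral_Ioi_rpow_of_lt (by linarith) one_pos, sub_add_cancel, zero_rpow hη.ne']
  have : -1 - η + 1 = -η := by ring
  rw [this]
  simp only [one_rpow]
  field_simp
  ring

lemma integrable_radialMajorant_norm {n : ℕ} (hn : 1 ≤ n) {η : ℝ} (hη : 0 < η) :
    Integrable (fun x : EuclideanSpace ℝ (Fin n) ↦ radialMajorant n η ‖x‖) := by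
  have : Nontrivial (EuclideanSpace ℝ (Fin n)) :=
    Module.nontrivial_of_finrank_pos (R := ℝ) (by rw [finrank_euclideanSpace_fin]; omega)
  rw [integrable_fun_norm_addHaar volume (f := radialMajorant n η), finrank_euclideanSpace_fin]
  exact (hasIntegral_radialMajorant hn hη).1

lemma integral_radialMajorant_norm {n : ℕ} (hn : 1 ≤ n) {η : ℝ} (hη : 0 < η) :
    ∫ x : EuclideanSpace ℝ (Fin n), radialMajorant n η ‖x‖ =
      n * volume.real (Metric.ball (0 : EuclideanSpace ℝ (Fin n)) 1) * (2 / η) := by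
  have : Nontrivial (EuclideanSpace ℝ (Fin n)) :=
    Module.nontrivial_of_finrank_pos (R := ℝ) (by rw [finrank_euclideanSpace_fin]; omega)
  rw [integral_fun_norm_addHaar volume (radialMajorant n η), finrank_euclideanSpace_fin,
    (hasIntegral_radialMajorant hn hη).2]
  simp only [nsmul_eq_mul, smul_eq_mul, mul_assoc]

/-- The product of two bubble profiles after rescaling the first one to unit size, normalised by
its expected order of magnitude. -/
noncomputable def rescaledDensity (n : ℕ) (a b r : ℝ) (e u : EuclideanSpace ℝ (Fin n)) : ℝ :=
  (1 + ‖u‖ ^ 2) ^ (-a) * ((1 + r ^ 2 + r ^ 2 * ‖e‖ ^ 2) / (1 + r ^ 2 * ‖u - e‖ ^ 2)) ^ b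

lemma rescaledDensity_nonneg (n : ℕ) (a b r : ℝ) (e u : EuclideanSpace ℝ (Fin n)) :
    0 ≤ rescaledDensity n a b r e u := by
  unfold rescaledDensity
  positivity

lemma rescaledDensity_le {n : ℕ} {a b η r : ℝ} (hb : 0 ≤ b) (hab : a + b = n) (hη : 0 < η)
    (hη' : η ≤ a - b) {e u : EuclideanSpace ℝ (Fin n)} (hu : u ≠ 0) (hue : u ≠ e) :
    rescaledDensity n a b r e u ≤
      4 ^ n * (radialMajorant n η ‖u‖ + radialMajorant n η ‖u - e‖) := by
  unfold rescaledDensity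
  have hd : ‖e‖ ≤ ‖u‖ + ‖u - e‖ := by
    have := norm_sub_le u (u - e)
    rwa [sub_sub_cancel] at this
  have hp : 0 < ‖u‖ := norm_pos_iff.mpr hu
  have hq : 0 < ‖u - e‖ := norm_pos_iff.mpr (sub_ne_zero.mpr hue)
  have hd0 := norm_nonneg e
  generalize ‖u - e‖ = q at *
  generalize ‖u‖ = p at *
  generalize ‖e‖ = d at *
  set A : ℝ := 1 + p ^ 2 with hA
  have hA1 : 1 ≤ A := by nlinarith
  have hA0 : 0 < A := by linarith
  set M : ℝ := max 1 (A / q ^ 2) with hM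
  have hM1 : 1 ≤ M := le_max_left _ _
  have hMA : A ≤ M * q ^ 2 := by
    rw [← div_le_iff₀ (by positivity)]
    exact le_max_right _ _
  have hR : (1 + r ^ 2 + r ^ 2 * d ^ 2) / (1 + r ^ 2 * q ^ 2) ≤ 4 * M := by
    rw [div_le_iff₀ (by positivity)]
    have h1 : 1 + d ^ 2 ≤ 2 * A + 2 * q ^ 2 := by nlinarith [sq_nonneg (p - q)]
    have h2 : 1 + d ^ 2 ≤ 4 * M * q ^ 2 := by nlinarith [sq_nonneg q]
    nlinarith [sq_nonneg r]
  have hmajp := radialMajorant_nonneg n η hp.le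
  have hmajq := radialMajorant_nonneg n η hq.le
  have hcore : A ^ (-a) * M ^ b ≤ radialMajorant n η p + radialMajorant n η q := by
    rcases le_total A (q ^ 2) with h | h
    · have hM' : M = 1 := max_eq_left ((div_le_one (by positivity)).mpr h)
      rw [hM', one_rpow, mul_one]
      refine le_trans ?_ (le_add_of_nonneg_right hmajq)
      unfold radialMajorant
      split_ifs with hp1
      · exact (rpow_le_one_of_one_le_of_nonpos hA1 (by linarith)).trans
          (one_le_rpow_of_pos_of_le_one_of_nonpos hp hp1 (by linarith))
      · push Not at hp1
        calc A ^ (-a) ≤ (p ^ 2) ^ (-a) :=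
              rpow_le_rpow_of_nonpos (by positivity) (by linarith) (by linarith)
          _ = p ^ (2 * -a) := by rw [← rpow_natCast, ← rpow_mul hp.le]; norm_num
          _ ≤ p ^ (-(n + η)) := rpow_le_rpow_of_exponent_le hp1.le (by linarith)
    · have hM' : M = A / q ^ 2 := max_eq_right ((one_le_div (by positivity)).mpr h)
      refine le_trans ?_ (le_add_of_nonneg_left hmajp)
      have hq2 (z : ℝ) : (q ^ 2) ^ z = q ^ (2 * z) := by
        rw [← rpow_natCast, ← rpow_mul hq.le]; norm_num
      have heq : A ^ (-a) * M ^ b = A ^ (b - a) * q ^ (2 * -b) := by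
        rw [hM', div_rpow hA0.le (by positivity), ← hq2, rpow_neg (by positivity) b, div_eq_mul_inv,
          ← mul_assoc, ← rpow_add hA0]
        ring_nf
      rw [heq]
      unfold radialMajorant
      split_ifs with hq1
      · calc A ^ (b - a) * q ^ (2 * -b) ≤ 1 * q ^ (2 * -b) := by
              gcongr
              exact rpow_le_one_of_one_le_of_nonpos hA1 (by linarith)
          _ ≤ q ^ (η - n) := by
              rw [one_mul]
              exact rpow_le_rpow_of_exponent_ge hq hq1 (by linarith)
      · push Not at hq1
        calc A ^ (b - a) * q ^ (2 * -b) ≤ (q ^ 2) ^ (b - a) * q ^ (2 * -b) := by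
              gcongr ?_ * _
              exact rpow_le_rpow_of_nonpos (by positivity) h (by linarith)
          _ = q ^ (2 * -a) := by
              rw [hq2, ← rpow_add hq]
              ring_nf
          _ ≤ q ^ (-(n + η)) := rpow_le_rpow_of_exponent_le hq1.le (by linarith)
  calc A ^ (-a) * ((1 + r ^ 2 + r ^ 2 * d ^ 2) / (1 + r ^ 2 * q ^ 2)) ^ b
      ≤ A ^ (-a) * (4 * M) ^ b := by gcongr
    _ = 4 ^ b * (A ^ (-a) * M ^ b) := by
        rw [mul_rpow (by norm_num) (by linarith)]
        ring
    _ ≤ 4 ^ (n : ℝ) * (radialMajorant n η p + radialMajorant n η q) := by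
        gcongr
        · norm_num
        · linarith
    _ = _ := by rw [rpow_natCast]

lemma integrable_rescaledDensity {n : ℕ} (hn : 1 ≤ n) {a b r : ℝ} (ha : 0 ≤ a) (hb : 0 ≤ b)
    (hab : a + b = n) (hr : 0 < r) (e : EuclideanSpace ℝ (Fin n)) :
    Integrable (rescaledDensity n a b r e) := by
  have hn' : (1 : ℝ) ≤ n := by exact_mod_cast hn
  have hbase : Integrable (fun x : EuclideanSpace ℝ (Fin n) ↦ ((1 : ℝ) + ‖x‖ ^ 2) ^ (-(n : ℝ))) := by
    have := integrable_rpow_neg_one_add_norm_sq (E := EuclideanSpace ℝ (Fin n)) (μ := volume)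
      (r := 2 * n) (by rw [finrank_euclideanSpace_fin]; linarith)
    convert this using 3
    ring
  have hbase' : Integrable
      (fun u : EuclideanSpace ℝ (Fin n) ↦ ((1 : ℝ) + ‖r • (u - e)‖ ^ 2) ^ (-(n : ℝ))) :=
    (hbase.comp_smul hr.ne').comp_sub_right e
  refine ((hbase.add hbase').const_mul ((1 + r ^ 2 + r ^ 2 * ‖e‖ ^ 2) ^ b)).mono' ?_ ?_
  · refine Continuous.aestronglyMeasurable ?_
    unfold rescaledDensity
    refine Continuous.mul (Continuous.rpow_const (by fun_prop) fun u ↦ Or.inl (by positivity))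
      (Continuous.rpow_const (Continuous.div (by fun_prop) (by fun_prop) fun u ↦ by positivity)
        fun u ↦ Or.inl (by positivity))
  · refine Filter.Eventually.of_forall fun u ↦ ?_
    rw [Real.norm_of_nonneg (rescaledDensity_nonneg n a b r e u)]
    unfold rescaledDensity
    simp only [Pi.add_apply, norm_smul, mul_pow, Real.norm_eq_abs, sq_abs]
    set A : ℝ := 1 + ‖u‖ ^ 2
    set B : ℝ := 1 + r ^ 2 * ‖u - e‖ ^ 2
    have hA : 0 < A := by positivity
    have hB : 0 < B := by positivity
    have key : A ^ (-a) * B ^ (-b) ≤ A ^ (-(n : ℝ)) + B ^ (-(n : ℝ)) := by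
      rcases le_total A B with h | h
      · calc A ^ (-a) * B ^ (-b) ≤ A ^ (-a) * A ^ (-b) := by
              gcongr ?_ * ?_
              exact rpow_le_rpow_of_nonpos hA h (by linarith)
          _ = A ^ (-(n : ℝ)) := by rw [← rpow_add hA, ← hab]; ring_nf
          _ ≤ _ := le_add_of_nonneg_right (by positivity)
      · calc A ^ (-a) * B ^ (-b) ≤ B ^ (-a) * B ^ (-b) := by
              gcongr ?_ * ?_
              exact rpow_le_rpow_of_nonpos hB h (by linarith)
          _ = B ^ (-(n : ℝ)) := by rw [← rpow_add hB, ← hab]; ring_nf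
          _ ≤ _ := le_add_of_nonneg_left (by positivity)
    rw [div_rpow (by positivity) hB.le, div_eq_mul_inv, ← rpow_neg hB.le]
    calc _ = (1 + r ^ 2 + r ^ 2 * ‖e‖ ^ 2) ^ b * (A ^ (-a) * B ^ (-b)) := by ring
      _ ≤ _ := by gcongr

lemma integral_rescaledDensity_le {n : ℕ} (hn : 1 ≤ n) {a b η r : ℝ} (ha : 0 ≤ a) (hb : 0 ≤ b)
    (hab : a + b = n) (hη : 0 < η) (hη' : η ≤ a - b) (hr : 0 < r)
    (e : EuclideanSpace ℝ (Fin n)) :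
    ∫ u, rescaledDensity n a b r e u ≤
      4 ^ (n + 1) * n * volume.real (Metric.ball (0 : EuclideanSpace ℝ (Fin n)) 1) / η := by
  have : Nontrivial (EuclideanSpace ℝ (Fin n)) :=
    Module.nontrivial_of_finrank_pos (R := ℝ) (by rw [finrank_euclideanSpace_fin]; omega)
  have hmaj := integrable_radialMajorant_norm hn hη
  have hmaj' := hmaj.comp_sub_right e
  calc ∫ u, rescaledDensity n a b r e u
      ≤ ∫ u : EuclideanSpace ℝ (Fin n),
          4 ^ n * (radialMajorant n η ‖u‖ + radialMajorant n η ‖u - e‖) := by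
        refine integral_mono_ae (integrable_rescaledDensity hn ha hb hab hr e)
          ((hmaj.add hmaj').const_mul _) ?_
        filter_upwards [Measure.ae_ne volume 0, Measure.ae_ne volume e] with u hu hue
        exact rescaledDensity_le hb hab hη hη' hu hue
    _ = _ := by
        rw [integral_const_mul, integral_add hmaj hmaj',
          integral_sub_right_eq_self (fun u : EuclideanSpace ℝ (Fin n) ↦ radialMajorant n η ‖u‖) e,
          integral_radialMajorant_norm hn hη]
        ring

lemma le_integral_rescaledDensity {n : ℕ} (hn : 1 ≤ n) {a b r : ℝ} (ha : 0 ≤ a) (hb : 0 ≤ b)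
    (hab : a + b = n) (hr : 0 < r) (e : EuclideanSpace ℝ (Fin n)) :
    (2 ^ n)⁻¹ * volume.real (Metric.ball (0 : EuclideanSpace ℝ (Fin n)) 1) ≤
      ∫ u, rescaledDensity n a b r e u := by
  have hint := integrable_rescaledDensity hn ha hb hab hr e
  calc (2 ^ n)⁻¹ * volume.real (Metric.ball (0 : EuclideanSpace ℝ (Fin n)) 1)
      = ∫ _u in Metric.ball (0 : EuclideanSpace ℝ (Fin n)) 1, ((2 : ℝ) ^ n)⁻¹ := by
        rw [setIntegral_const, smul_eq_mul, mul_comm]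
    _ ≤ ∫ u in Metric.ball (0 : EuclideanSpace ℝ (Fin n)) 1, rescaledDensity n a b r e u := by
        refine setIntegral_mono_on (integrableOn_const measure_ball_lt_top.ne) hint.integrableOn
          measurableSet_ball fun u hu ↦ ?_
        have hu1 : ‖u‖ < 1 := by simpa using hu
        have hu0 := norm_nonneg u
        have hsub := norm_sub_le u e
        have hsub0 := norm_nonneg (u - e)
        unfold rescaledDensity
        have hA : ((2 : ℝ)⁻¹) ^ a ≤ (1 + ‖u‖ ^ 2) ^ (-a) := by
          rw [inv_rpow zero_le_two, ← rpow_neg zero_le_two]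
          exact rpow_le_rpow_of_nonpos (by positivity) (by nlinarith) (by linarith)
        have hR : (2 : ℝ)⁻¹ ≤ (1 + r ^ 2 + r ^ 2 * ‖e‖ ^ 2) / (1 + r ^ 2 * ‖u - e‖ ^ 2) := by
          rw [le_div_iff₀ (by positivity)]
          have : ‖u - e‖ ^ 2 ≤ 2 + 2 * ‖e‖ ^ 2 := by nlinarith [sq_nonneg (‖u‖ - ‖e‖)]
          nlinarith [sq_nonneg r]
        calc ((2 : ℝ) ^ n)⁻¹ = (2⁻¹) ^ a * (2⁻¹) ^ b := by
              rw [← rpow_add (by norm_num), hab, rpow_natCast, inv_pow]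
          _ ≤ _ := by gcongr
    _ ≤ _ := setIntegral_le_integral hint
        (Filter.Eventually.of_forall (rescaledDensity_nonneg n a b r e))

lemma integral_annulus_rpow_neg {n : ℕ} (hn : 1 ≤ n) {ρ : ℝ} (hρ : 1 ≤ ρ) :
    ∫ x : EuclideanSpace ℝ (Fin n), (Set.Ioc 1 ρ).indicator (fun y : ℝ ↦ y ^ (-(n : ℝ))) ‖x‖ =
      n * volume.real (Metric.ball (0 : EuclideanSpace ℝ (Fin n)) 1) * log ρ := by
  have : Nontrivial (EuclideanSpace ℝ (Fin n)) :=
    Module.nontrivial_of_finrank_pos (R := ℝ) (by rw [finrank_euclideanSpace_fin]; omega)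
  rw [integral_fun_norm_addHaar volume, finrank_euclideanSpace_fin]
  have hfun : (fun y : ℝ ↦ y ^ (n - 1) • (Set.Ioc 1 ρ).indicator (fun y : ℝ ↦ y ^ (-(n : ℝ))) y) =
      (Set.Ioc 1 ρ).indicator fun y : ℝ ↦ y⁻¹ := by
    ext y
    by_cases hy : y ∈ Set.Ioc 1 ρ
    · rw [Set.indicator_of_mem hy, Set.indicator_of_mem hy, smul_eq_mul,
        natPow_pred_mul_rpow hn (by linarith [hy.1]), ← rpow_neg_one]
      ring_nf
    · simp [Set.indicator_of_notMem hy]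
  have hsub : Set.Ioi 0 ∩ Set.Ioc 1 ρ = Set.Ioc 1 ρ :=
    Set.inter_eq_right.mpr fun y hy ↦ lt_trans one_pos hy.1
  rw [hfun, setIntegral_indicator measurableSet_Ioc, hsub, ← intervalIntegral.integral_of_le hρ,
    integral_inv_of_pos one_pos (by linarith), div_one, nsmul_eq_mul, smul_eq_mul, mul_assoc]

lemma log_le_integral_rescaledDensity {n : ℕ} (hn : 1 ≤ n) {r ρ : ℝ} (hr : 0 < r) (hρ : 1 ≤ ρ)
    (e : EuclideanSpace ℝ (Fin n)) (hrρ : r ^ 2 * ρ ^ 2 ≤ 1 + r ^ 2 + r ^ 2 * ‖e‖ ^ 2) :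
    (4 ^ n)⁻¹ * (n * volume.real (Metric.ball (0 : EuclideanSpace ℝ (Fin n)) 1) * log ρ) ≤
      ∫ u, rescaledDensity n (n / 2) (n / 2) r e u := by
  rw [← integral_annulus_rpow_neg hn hρ, ← integral_const_mul]
  refine integral_mono_of_nonneg (Filter.Eventually.of_forall fun u ↦ ?_)
    (integrable_rescaledDensity hn (by positivity) (by positivity) (by ring) hr e)
    (Filter.Eventually.of_forall fun u ↦ ?_)
  · exact mul_nonneg (by positivity)
      (Set.indicator_nonneg (fun y hy ↦ rpow_nonneg (by linarith [hy.1]) _) _)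
  · dsimp only
    by_cases hu : ‖u‖ ∈ Set.Ioc 1 ρ
    · rw [Set.indicator_of_mem hu]
      unfold rescaledDensity
      have hsub := norm_sub_le u e
      have hsub0 := norm_nonneg (u - e)
      obtain ⟨hu1, hu2⟩ := hu
      have hu0 : 0 < ‖u‖ := by linarith
      have hA : (2 * ‖u‖ ^ 2) ^ (-(n / 2 : ℝ)) ≤ (1 + ‖u‖ ^ 2) ^ (-(n / 2 : ℝ)) :=
        rpow_le_rpow_of_nonpos (by positivity) (by nlinarith) (by simp; positivity)
      have hR : (8 : ℝ)⁻¹ ≤ (1 + r ^ 2 + r ^ 2 * ‖e‖ ^ 2) / (1 + r ^ 2 * ‖u - e‖ ^ 2) := by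
        rw [le_div_iff₀ (by positivity)]
        have h1 : ‖u - e‖ ^ 2 ≤ 2 * ρ ^ 2 + 2 * ‖e‖ ^ 2 := by
          nlinarith [sq_nonneg (‖u‖ - ‖e‖)]
        have h2 : r ^ 2 * ‖u - e‖ ^ 2 ≤ r ^ 2 * (2 * ρ ^ 2 + 2 * ‖e‖ ^ 2) := by gcongr
        nlinarith [sq_nonneg r]
      have heq : ((4 : ℝ) ^ n)⁻¹ * ‖u‖ ^ (-(n : ℝ)) =
          (2 * ‖u‖ ^ 2) ^ (-(n / 2 : ℝ)) * (8⁻¹) ^ (n / 2 : ℝ) := by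
        rw [inv_rpow (by norm_num), ← rpow_neg (by norm_num), ← mul_rpow (by positivity)
          (by norm_num), show 2 * ‖u‖ ^ 2 * 8 = (4 * ‖u‖) ^ (2 : ℝ) by rw [rpow_two]; ring,
          ← rpow_mul (by positivity), show 2 * -(n / 2 : ℝ) = -n by ring,
          mul_rpow (by norm_num) hu0.le, rpow_neg (zero_le_four (α := ℝ)), rpow_natCast]
      rw [heq]
      gcongr
    · rw [Set.indicator_of_notMem hu, mul_zero]
      exact rescaledDensity_nonneg _ _ _ _ _ _

/-- The bubble `W[ξ,λ]` without its normalization constant and conformal exponent. -/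
noncomputable def bubbleProfile {n : ℕ} (lam : ℝ) (ξ x : EuclideanSpace ℝ (Fin n)) : ℝ :=
  lam / (1 + lam ^ 2 * ‖x - ξ‖ ^ 2)

/-- The conformal separation of two bubbles, a negative power of which is `bubbleQ`. -/
noncomputable def bubbleSeparation {n : ℕ} (li lj : ℝ) (ξi ξj : EuclideanSpace ℝ (Fin n)) : ℝ :=
  li / lj + lj / li + li * lj * ‖ξi - ξj‖ ^ 2

section

variable {n : ℕ} {li lj : ℝ} {ξi ξj : EuclideanSpace ℝ (Fin n)}

lemma bubbleProfile_pos {lam : ℝ} (h : 0 < lam) (ξ x : EuclideanSpace ℝ (Fin n)) :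
    0 < bubbleProfile lam ξ x := by
  unfold bubbleProfile
  positivity

lemma bubbleSeparation_comm (li lj : ℝ) (ξi ξj : EuclideanSpace ℝ (Fin n)) :
    bubbleSeparation li lj ξi ξj = bubbleSeparation lj li ξj ξi := by
  unfold bubbleSeparation
  rw [norm_sub_rev]
  ring

lemma one_le_bubbleSeparation (hi : 0 < li) (hj : 0 < lj) :
    1 ≤ bubbleSeparation li lj ξi ξj := by
  unfold bubbleSeparation
  have h : 1 ≤ li / lj + lj / li := by
    rcases le_total li lj with h | h
    · have := (one_le_div hi).mpr h
      have : 0 < li / lj := by positivity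
      linarith
    · have := (one_le_div hj).mpr h
      have : 0 < lj / li := by positivity
      linarith
  have : 0 ≤ li * lj * ‖ξi - ξj‖ ^ 2 := by positivity
  linarith

lemma bubbleSeparation_eq (hi : 0 < li) (hj : 0 < lj) :
    bubbleSeparation li lj ξi ξj =
      (1 + (lj / li) ^ 2 + (lj / li) ^ 2 * ‖li • (ξj - ξi)‖ ^ 2) / (lj / li) := by
  unfold bubbleSeparation
  rw [norm_smul, norm_sub_rev ξj ξi, mul_pow, Real.norm_eq_abs, sq_abs]
  field_simp

lemma bubbleProfile_rpow_mul (hi : 0 < li) (hj : 0 < lj) {a b : ℝ} (hab : a + b = n)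
    (x : EuclideanSpace ℝ (Fin n)) :
    bubbleProfile li ξi x ^ a * bubbleProfile lj ξj x ^ b =
      li ^ n * bubbleSeparation li lj ξi ξj ^ (-b) *
        rescaledDensity n a b (lj / li) (li • (ξj - ξi)) (li • (x - ξi)) := by
  rw [bubbleSeparation_eq hi hj]
  unfold rescaledDensity
  set N : ℝ := 1 + (lj / li) ^ 2 + (lj / li) ^ 2 * ‖li • (ξj - ξi)‖ ^ 2 with hN
  have hN0 : 0 < N := by positivity
  have hdiff : li • (x - ξi) - li • (ξj - ξi) = li • (x - ξj) := by
    rw [← smul_sub, sub_sub_sub_cancel_right]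
  have hA : bubbleProfile li ξi x = li / (1 + ‖li • (x - ξi)‖ ^ 2) := by
    unfold bubbleProfile
    rw [norm_smul, mul_pow, Real.norm_eq_abs, sq_abs]
  set A : ℝ := 1 + ‖li • (x - ξi)‖ ^ 2
  have hA0 : 0 < A := by positivity
  have hB : bubbleProfile lj ξj x =
      li * ((lj / li) / N * (N / (1 + (lj / li) ^ 2 * ‖li • (x - ξj)‖ ^ 2))) := by
    unfold bubbleProfile
    rw [norm_smul, mul_pow, Real.norm_eq_abs, sq_abs]
    field_simp
  rw [hdiff, hA, hB, mul_rpow hi.le (by positivity), mul_rpow (by positivity) (by positivity),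
    div_rpow hi.le hA0.le, rpow_neg hA0.le, rpow_neg (by positivity), ← inv_rpow (by positivity),
    inv_div, ← rpow_natCast li, ← hab, rpow_add hi]
  ring

lemma integrable_bubbleProfile (hn : 1 ≤ n) (hi : 0 < li) (hj : 0 < lj) {a b : ℝ} (ha : 0 ≤ a)
    (hb : 0 ≤ b) (hab : a + b = n) :
    Integrable fun x ↦ bubbleProfile li ξi x ^ a * bubbleProfile lj ξj x ^ b := by
  simp_rw [bubbleProfile_rpow_mul hi hj hab]
  exact (((integrable_rescaledDensity hn ha hb hab (div_pos hj hi) _).comp_smul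
    hi.ne').comp_sub_right ξi).const_mul _

lemma integral_bubbleProfile (hi : 0 < li) (hj : 0 < lj) {a b : ℝ} (hab : a + b = n) :
    ∫ x, bubbleProfile li ξi x ^ a * bubbleProfile lj ξj x ^ b =
      bubbleSeparation li lj ξi ξj ^ (-b) *
        ∫ u, rescaledDensity n a b (lj / li) (li • (ξj - ξi)) u := by
  simp_rw [bubbleProfile_rpow_mul hi hj hab]
  rw [integral_const_mul, integral_sub_right_eq_self
    (fun x ↦ rescaledDensity n a b (lj / li) (li • (ξj - ξi)) (li • x)) ξi,
    Measure.integral_comp_smul, finrank_euclideanSpace_fin, abs_of_pos (by positivity), smul_eq_mul]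
  field_simp

lemma integral_bubbleProfile_comm (a b : ℝ) :
    ∫ x, bubbleProfile li ξi x ^ a * bubbleProfile lj ξj x ^ b =
      ∫ x, bubbleProfile lj ξj x ^ b * bubbleProfile li ξi x ^ a := by
  simp_rw [mul_comm]

end

/-- The measure of the unit ball of `ℝⁿ`. -/
noncomputable def unitBallVolume (n : ℕ) : ℝ :=
  volume.real (Metric.ball (0 : EuclideanSpace ℝ (Fin n)) 1)

lemma unitBallVolume_pos (n : ℕ) : 0 < unitBallVolume n :=
  ENNReal.toReal_pos (Metric.measure_ball_pos _ _ one_pos).ne' measure_ball_lt_top.ne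

section

variable {n : ℕ} {li lj : ℝ} {ξi ξj : EuclideanSpace ℝ (Fin n)}

lemma rpow_min_le_integral_bubbleProfile (hn : 1 ≤ n) (hi : 0 < li) (hj : 0 < lj) {a b : ℝ}
    (ha : 0 ≤ a) (hb : 0 ≤ b) (hab : a + b = n) :
    (2 ^ n)⁻¹ * unitBallVolume n * bubbleSeparation li lj ξi ξj ^ (-min a b) ≤
      ∫ x, bubbleProfile li ξi x ^ a * bubbleProfile lj ξj x ^ b := by
  have hP := one_le_bubbleSeparation (ξi := ξi) (ξj := ξj) hi hj
  wlog h : b ≤ a generalizing a b li lj ξi ξj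
  · rw [integral_bubbleProfile_comm, bubbleSeparation_comm, min_comm]
    exact this hj hi hb ha (by linarith) (one_le_bubbleSeparation hj hi) (by linarith)
  rw [integral_bubbleProfile hi hj hab, min_eq_right h, mul_comm]
  gcongr
  exact le_integral_rescaledDensity hn ha hb hab (div_pos hj hi) _

lemma integral_bubbleProfile_le_rpow_min (hn : 1 ≤ n) (hi : 0 < li) (hj : 0 < lj) {a b η : ℝ}
    (ha : 0 ≤ a) (hb : 0 ≤ b) (hab : a + b = n) (hη : 0 < η) (hη' : η ≤ |a - b|) :
    ∫ x, bubbleProfile li ξi x ^ a * bubbleProfile lj ξj x ^ b ≤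
      4 ^ (n + 1) * n * unitBallVolume n / η * bubbleSeparation li lj ξi ξj ^ (-min a b) := by
  have hP := one_le_bubbleSeparation (ξi := ξi) (ξj := ξj) hi hj
  wlog h : b ≤ a generalizing a b li lj ξi ξj
  · rw [integral_bubbleProfile_comm, bubbleSeparation_comm, min_comm]
    exact this hj hi hb ha (by linarith) (by rwa [abs_sub_comm]) (one_le_bubbleSeparation hj hi)
      (by linarith)
  rw [abs_of_nonneg (by linarith)] at hη'
  rw [integral_bubbleProfile hi hj hab, min_eq_right h, mul_comm]
  gcongr
  exact integral_rescaledDensity_le hn ha hb hab hη hη' (div_pos hj hi) _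

lemma log_le_integral_bubbleProfile (hn : 1 ≤ n) (hi : 0 < li) (hj : 0 < lj) :
    (4 ^ n)⁻¹ * n * unitBallVolume n / 2 *
        (bubbleSeparation li lj ξi ξj ^ (-(n / 2 : ℝ)) * log (bubbleSeparation li lj ξi ξj)) ≤
      ∫ x, bubbleProfile li ξi x ^ (n / 2 : ℝ) * bubbleProfile lj ξj x ^ (n / 2 : ℝ) := by
  wlog h : lj ≤ li generalizing li lj ξi ξj
  · rw [integral_bubbleProfile_comm, bubbleSeparation_comm]
    exact this hj hi (by linarith)
  have hP := one_le_bubbleSeparation (ξi := ξi) (ξj := ξj) hi hj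
  set P := bubbleSeparation li lj ξi ξj with hPdef
  have hr : 0 < lj / li := div_pos hj hi
  have hr1 : lj / li ≤ 1 := (div_le_one hi).mpr h
  have hrP : (lj / li) ^ 2 * √P ^ 2 ≤
      1 + (lj / li) ^ 2 + (lj / li) ^ 2 * ‖li • (ξj - ξi)‖ ^ 2 := by
    have hrN : lj / li * P = 1 + (lj / li) ^ 2 + (lj / li) ^ 2 * ‖li • (ξj - ξi)‖ ^ 2 := by
      rw [hPdef, bubbleSeparation_eq hi hj]
      exact mul_div_cancel₀ _ hr.ne'
    rw [sq_sqrt (by linarith), ← hrN]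
    gcongr
    nlinarith
  rw [integral_bubbleProfile hi hj (add_halves _), ← hPdef]
  calc _ = P ^ (-(n / 2 : ℝ)) * ((4 ^ n)⁻¹ * (n * unitBallVolume n * log √P)) := by
        rw [log_sqrt (by linarith)]
        ring
    _ ≤ _ := by
        gcongr
        exact log_le_integral_rescaledDensity hn hr (one_le_sqrt.mpr hP) _ hrP

lemma rpow_mul_rpow_self_le {x y : ℝ} (hx : 0 < x) (hy : 0 < y) (m : ℝ) {h : ℝ} (hh : 0 ≤ h) :
    x ^ m * y ^ m ≤ x ^ (m + h) * y ^ (m - h) + x ^ (m - h) * y ^ (m + h) := by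
  wlog hxy : y ≤ x generalizing x y
  · have := this hy hx (by linarith)
    linarith
  have heq : x ^ m * y ^ m = x ^ m * y ^ (m - h) * y ^ h := by
    rw [mul_assoc, ← rpow_add hy, sub_add_cancel]
  have heq' : x ^ (m + h) * y ^ (m - h) = x ^ m * y ^ (m - h) * x ^ h := by
    rw [rpow_add hx]
    ring
  rw [heq, heq']
  refine le_trans ?_ (le_add_of_nonneg_right (by positivity))
  gcongr

lemma integral_bubbleProfile_le_log (hn : 1 ≤ n) (hi : 0 < li) (hj : 0 < lj)
    (hP : 1 ≤ log (bubbleSeparation li lj ξi ξj)) :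
    ∫ x, bubbleProfile li ξi x ^ (n / 2 : ℝ) * bubbleProfile lj ξj x ^ (n / 2 : ℝ) ≤
      2 * exp (1 / 2) * (4 ^ (n + 1) * n * unitBallVolume n) *
        (bubbleSeparation li lj ξi ξj ^ (-(n / 2 : ℝ)) * log (bubbleSeparation li lj ξi ξj)) := by
  have hP1 := one_le_bubbleSeparation (ξi := ξi) (ξj := ξj) hi hj
  have hn' : (1 : ℝ) ≤ n := by exact_mod_cast hn
  set P := bubbleSeparation li lj ξi ξj with hPdef
  set L := log P with hL
  have hL0 : 0 < L := by linarith
  have hη0 : 0 < 1 / L := by positivity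
  have hη1 : 1 / L ≤ 1 := (div_le_one hL0).mpr hP
  set h : ℝ := 1 / L / 2 with hh
  set K : ℝ := 4 ^ (n + 1) * n * unitBallVolume n
  have hplus : 0 ≤ (n / 2 : ℝ) + h := by positivity
  have hminus : 0 ≤ (n / 2 : ℝ) - h := by linarith
  have hpow : P ^ (-((n / 2 : ℝ) - h)) = P ^ (-(n / 2 : ℝ)) * exp (1 / 2) := by
    rw [show -((n / 2 : ℝ) - h) = -(n / 2 : ℝ) + h by ring, rpow_add (by linarith),
      rpow_def_of_pos (by linarith) h, ← hL]
    congr 2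
    rw [hh]
    field_simp
  have hbound1 := integral_bubbleProfile_le_rpow_min (ξi := ξi) (ξj := ξj) hn hi hj hplus hminus
    (by ring) hη0 (by rw [abs_of_nonneg (by linarith)]; linarith)
  have hbound2 := integral_bubbleProfile_le_rpow_min (ξi := ξi) (ξj := ξj) hn hi hj hminus hplus
    (by ring) hη0 (by rw [abs_sub_comm, abs_of_nonneg (by linarith)]; linarith)
  rw [min_eq_right (by linarith), ← hPdef, hpow] at hbound1
  rw [min_eq_left (by linarith), ← hPdef, hpow] at hbound2
  have hint1 := integrable_bubbleProfile (ξi := ξi) (ξj := ξj) hn hi hj hplus hminus (by ring)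
  have hint2 := integrable_bubbleProfile (ξi := ξi) (ξj := ξj) hn hi hj hminus hplus (by ring)
  have hsum := integral_mono (integrable_bubbleProfile (ξi := ξi) (ξj := ξj) hn hi hj
    (by positivity) (by positivity) (add_halves _)) (hint1.add hint2) fun x ↦
      rpow_mul_rpow_self_le (bubbleProfile_pos hi ξi x) (bubbleProfile_pos hj ξj x) (n / 2)
        (h := h) (by positivity)
  rw [integral_add' hint1 hint2] at hsum
  have hK : K / (1 / L) = K * L := by field_simp
  rw [hK] at hbound1 hbound2
  linarith

lemma bubble_rpow_mul {α s t : ℝ} (hα : 0 < α) (hi : 0 < li) (hj : 0 < lj)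
    (x : EuclideanSpace ℝ (Fin n)) :
    bubble n α li ξi x ^ s * bubble n α lj ξj x ^ t =
      α ^ (s + t) * (bubbleProfile li ξi x ^ (((n : ℝ) - 2) / 2 * s) *
        bubbleProfile lj ξj x ^ (((n : ℝ) - 2) / 2 * t)) := by
  have hXi := (bubbleProfile_pos hi ξi x).le
  have hXj := (bubbleProfile_pos hj ξj x).le
  rw [show bubble n α li ξi x = α * bubbleProfile li ξi x ^ (((n : ℝ) - 2) / 2) from rfl,
    show bubble n α lj ξj x = α * bubbleProfile lj ξj x ^ (((n : ℝ) - 2) / 2) from rfl,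
    mul_rpow hα.le (by positivity), mul_rpow hα.le (by positivity), ← rpow_mul hXi,
    ← rpow_mul hXj, rpow_add hα]
  ring

lemma bubbleQ_rpow (hi : 0 < li) (hj : 0 < lj) (z : ℝ) :
    bubbleQ n li lj ξi ξj ^ z = bubbleSeparation li lj ξi ξj ^ (-(((n : ℝ) - 2) / 2 * z)) := by
  have hP := one_le_bubbleSeparation (ξi := ξi) (ξj := ξj) hi hj
  rw [show bubbleQ n li lj ξi ξj = bubbleSeparation li lj ξi ξj ^ (-(((n : ℝ) - 2) / 2)) from rfl,
    ← rpow_mul (by linarith), neg_mul]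

lemma log_one_div_bubbleQ (hi : 0 < li) (hj : 0 < lj) :
    log (1 / bubbleQ n li lj ξi ξj) = ((n : ℝ) - 2) / 2 * log (bubbleSeparation li lj ξi ξj) := by
  have hP := one_le_bubbleSeparation (ξi := ξi) (ξj := ξj) hi hj
  rw [show bubbleQ n li lj ξi ξj = bubbleSeparation li lj ξi ξj ^ (-(((n : ℝ) - 2) / 2)) from rfl,
    one_div, log_inv, log_rpow (by linarith)]
  ring

end

theorem stmt10 (n : ℕ) (hn : 3 ≤ n) (μ α ε : ℝ) (hμ0 : 0 < μ) (hμn : μ < (n : ℝ))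
    (hα : 0 < α) (hε : 0 < ε) :
    ∃ c C δ : ℝ, 0 < c ∧ 0 < C ∧ 0 < δ ∧
      ∀ (ξi ξj : EuclideanSpace ℝ (Fin n)) (li lj : ℝ), 0 < li → 0 < lj →
        ((∀ s t : ℝ, 0 ≤ s → 0 ≤ t → s + t = 2 * (n : ℝ) / ((n : ℝ) - 2) →
            ε ≤ |s - t| →
            c * bubbleQ n li lj ξi ξj ^ min s t ≤
                (∫ x : EuclideanSpace ℝ (Fin n),
                  bubble n α li ξi x ^ s * bubble n α lj ξj x ^ t) ∧
            (∫ x : EuclideanSpace ℝ (Fin n),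
                bubble n α li ξi x ^ s * bubble n α lj ξj x ^ t) ≤
              C * bubbleQ n li lj ξi ξj ^ min s t) ∧
         (bubbleQ n li lj ξi ξj ≤ δ →
            c * bubbleQ n li lj ξi ξj ^ ((n : ℝ) / ((n : ℝ) - 2)) *
                Real.log (1 / bubbleQ n li lj ξi ξj) ≤
              (∫ x : EuclideanSpace ℝ (Fin n),
                bubble n α li ξi x ^ ((n : ℝ) / ((n : ℝ) - 2)) *
                  bubble n α lj ξj x ^ ((n : ℝ) / ((n : ℝ) - 2))) ∧
            (∫ x : EuclideanSpace ℝ (Fin n),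
                bubble n α li ξi x ^ ((n : ℝ) / ((n : ℝ) - 2)) *
                  bubble n α lj ξj x ^ ((n : ℝ) / ((n : ℝ) - 2))) ≤
              C * bubbleQ n li lj ξi ξj ^ ((n : ℝ) / ((n : ℝ) - 2)) *
                Real.log (1 / bubbleQ n li lj ξi ξj))) := by
  have hn1 : 1 ≤ n := by omega
  have hn3 : (3 : ℝ) ≤ n := by exact_mod_cast hn
  set m : ℝ := ((n : ℝ) - 2) / 2 with hm
  have hm0 : 0 < m := by linarith
  have hn2 : (n : ℝ) - 2 ≠ 0 := by linarith
  have hmtot : m * (2 * (n : ℝ) / ((n : ℝ) - 2)) = n := by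
    rw [hm]
    field_simp
  have hmhalf : m * ((n : ℝ) / ((n : ℝ) - 2)) = n / 2 := by
    rw [hm]
    field_simp
  have hV := unitBallVolume_pos n
  set κ : ℝ := α ^ (2 * (n : ℝ) / ((n : ℝ) - 2))
  have hκ : 0 < κ := by positivity
  set c₁ : ℝ := (2 ^ n)⁻¹ * unitBallVolume n
  set c₂ : ℝ := (4 ^ n)⁻¹ * n * unitBallVolume n / 2
  set C₁ : ℝ := 4 ^ (n + 1) * n * unitBallVolume n / (m * ε)
  set C₂ : ℝ := 2 * exp (1 / 2) * (4 ^ (n + 1) * n * unitBallVolume n)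
  have hc₁ : 0 < c₁ := by positivity
  have hc₂ : 0 < c₂ := by positivity
  have hC₁ : 0 < C₁ := by positivity
  have hC₂ : 0 < C₂ := by positivity
  refine ⟨κ * min c₁ (c₂ / m), κ * max C₁ (C₂ / m), exp (-m), by positivity, by positivity,
    exp_pos _, fun ξi ξj li lj hi hj ↦ ⟨fun s t hs ht hst hε' ↦ ?_, fun hQ ↦ ?_⟩⟩
  · simp_rw [bubble_rpow_mul hα hi hj]
    rw [integral_const_mul, hst, bubbleQ_rpow hi hj, ← hm, mul_min_of_nonneg _ _ hm0.le]
    have hab : m * s + m * t = n := by rw [← mul_add, hst, hmtot]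
    have hlow := rpow_min_le_integral_bubbleProfile (ξi := ξi) (ξj := ξj) hn1 hi hj
      (a := m * s) (b := m * t) (by positivity) (by positivity) hab
    have hupp := integral_bubbleProfile_le_rpow_min (ξi := ξi) (ξj := ξj) hn1 hi hj
      (a := m * s) (b := m * t) (η := m * ε) (by positivity) (by positivity) hab (by positivity)
      (by rw [← mul_sub, abs_mul, abs_of_pos hm0]; gcongr)
    have hP := one_le_bubbleSeparation (ξi := ξi) (ξj := ξj) hi hj
    rw [mul_assoc, mul_assoc]
    constructor
    · gcongr
      refine le_trans ?_ hlow
      gcongr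
      exact min_le_left _ _
    · gcongr
      refine hupp.trans ?_
      gcongr
      exact le_max_left _ _
  · have hlogQ := log_one_div_bubbleQ (ξi := ξi) (ξj := ξj) hi hj
    have hP := one_le_bubbleSeparation (ξi := ξi) (ξj := ξj) hi hj
    have hQ0 : 0 < bubbleQ n li lj ξi ξj := rpow_pos_of_pos (zero_lt_one.trans_le hP) _
    have hlog1 : 1 ≤ log (bubbleSeparation li lj ξi ξj) := by
      have hlog := log_le_log hQ0 hQ
      rw [log_exp] at hlog
      rw [one_div, log_inv, ← hm] at hlogQ
      exact le_of_mul_le_mul_left (by linarith) hm0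
    simp_rw [bubble_rpow_mul hα hi hj]
    rw [integral_const_mul, ← two_mul, ← mul_div_assoc, bubbleQ_rpow hi hj, hlogQ, ← hm, hmhalf]
    have hlow := log_le_integral_bubbleProfile (ξi := ξi) (ξj := ξj) hn1 hi hj
    have hupp := integral_bubbleProfile_le_log (ξi := ξi) (ξj := ξj) hn1 hi hj hlog1
    set P := bubbleSeparation li lj ξi ξj
    have hPL : 0 ≤ P ^ (-(n / 2 : ℝ)) * log P := by positivity
    have hassoc (z : ℝ) : κ * z * P ^ (-(n / 2 : ℝ)) * (m * log P) =
        κ * (z * m * (P ^ (-(n / 2 : ℝ)) * log P)) := by ring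
    rw [hassoc, hassoc]
    constructor
    · gcongr
      exact (mul_le_mul_of_nonneg_right ((le_div_iff₀ hm0).mp (min_le_right _ _)) hPL).trans hlow
    · gcongr
      exact hupp.trans
        (mul_le_mul_of_nonneg_right ((div_le_iff₀ hm0).mp (le_max_right _ _)) hPL)
end

section
/- Let $\alpha_1, \beta_1 \ge 0$ and $\beta_1 \ge \gamma_1 \ge 0$. Let $\lambda_k \le \lambda_j$ be positive reals, $\xi_k, \xi_j \in \mathbb{R}^n$, and set $z_k = \lambda_k(x - \xi_k)$, $z_j = \lambda_j(x - \xi_j)$, $\tau(z) = (1+|z|^2)^{1/2}$, and $\mathscr{R}_{kj} = \max\{\sqrt{\lambda_j/\lambda_k}, \sqrt{\lambda_k \lambda_j}\,|\xi_k - \xi_j|\}$ with $\mathscr{R}_{kj} \ge 2$. Then there is a constant $C$ (depending on the exponents and $n$) such that: (a) if $|z_j| \le \sqrt{\lambda_j/\lambda_k}\, \mathscr{R}_{kj}/2$ then $\tau(z_k)^{-\alpha_1}\tau(z_j)^{-\beta_1} \le C \mathscr{R}_{kj}^{-\alpha_1} (\lambda_j/\lambda_k)^{\alpha_1/2} \tau(z_j)^{-\beta_1}$;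 (b) if $|z_j| \ge \sqrt{\lambda_j/\lambda_k}\, \mathscr{R}_{kj}/2$ then $\tau(z_k)^{-\alpha_1}\tau(z_j)^{-\beta_1} \le C \mathscr{R}_{kj}^{-\gamma_1} (\lambda_j/\lambda_k)^{\beta_1 - \gamma_1/2} \tau(z_k)^{-(\alpha_1+\beta_1-\gamma_1)}$. -/
open Real

/-- The interaction scale `𝒭_{kj}` of two bubbles (with `λ_k ≤ λ_j`). -/
noncomputable def Rkj (n : ℕ) (lk lj : ℝ) (ξk ξj : EuclideanSpace ℝ (Fin n)) : ℝ :=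
  max (Real.sqrt (lj / lk)) (Real.sqrt (lk * lj) * ‖ξk - ξj‖)

lemma Rkj_eq_sqrt_mul_max {n : ℕ} {lk lj : ℝ} (hk : 0 < lk) (hj : 0 < lj)
    (ξk ξj : EuclideanSpace ℝ (Fin n)) :
    Rkj n lk lj ξk ξj = √(lj / lk) * max 1 (lk * ‖ξk - ξj‖) := by
  have h : √(lk * lj) = √(lj / lk) * lk := by
    rw [show lk * lj = lj / lk * lk ^ 2 by field_simp, Real.sqrt_mul (by positivity),
      Real.sqrt_sq hk.le]
  rw [Rkj, mul_max_of_nonneg _ _ (Real.sqrt_nonneg _), h, mul_one, mul_assoc]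

lemma sqrt_mul_rpow_neg {r M : ℝ} (hr : 0 ≤ r) (hM : 0 ≤ M) (s : ℝ) :
    (√r * M) ^ (-s) = r ^ (-s / 2) * M ^ (-s) := by
  rw [Real.mul_rpow (Real.sqrt_nonneg _) hM, Real.sqrt_eq_rpow, ← Real.rpow_mul hr]
  ring_nf

lemma sq_rpow_neg_half {t : ℝ} (ht : 0 ≤ t) (s : ℝ) : (t ^ 2) ^ (-s / 2) = t ^ (-s) := by
  rw [← Real.rpow_natCast, ← Real.rpow_mul ht]
  push_cast
  ring_nf

lemma rpow_neg_half_le_of_sq_le {t u s : ℝ} (ht : 0 < t) (hs : 0 ≤ s) (h : t ^ 2 ≤ u) :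
    u ^ (-s / 2) ≤ t ^ (-s) := by
  rw [← sq_rpow_neg_half ht.le]
  exact Real.rpow_le_rpow_of_nonpos (by positivity) h (by linarith)

lemma rpow_neg_le_rpow_neg_half {t u s : ℝ} (ht : 0 ≤ t) (hu : 0 < u) (hs : 0 ≤ s)
    (h : u ≤ t ^ 2) : t ^ (-s) ≤ u ^ (-s / 2) := by
  rw [← sq_rpow_neg_half ht]
  exact Real.rpow_le_rpow_of_nonpos hu h (by linarith)

lemma weight_le_of_half_le {α M a : ℝ} (hα : 0 ≤ α) (hM : 0 < M) (h : (M / 2) ^ 2 ≤ 1 + a ^ 2) :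
    (1 + a ^ 2) ^ (-α / 2) ≤ 2 ^ α * M ^ (-α) := by
  refine (rpow_neg_half_le_of_sq_le (half_pos hM) hα h).trans_eq ?_
  rw [Real.div_rpow hM.le zero_le_two, Real.rpow_neg zero_le_two, div_inv_eq_mul, mul_comm]

lemma weight_le_of_comparable {β γ M a b c : ℝ} (hγ : 0 ≤ γ) (hγβ : γ ≤ β) (hM : 0 < M)
    (hc : 0 < c) (hMc : M ≤ 4 * c) (ha : 1 + a ^ 2 ≤ (4 * c) ^ 2) (hb : c ^ 2 ≤ 1 + b ^ 2) :
    (1 + b ^ 2) ^ (-β / 2) ≤ 4 ^ β * (M ^ (-γ) * (1 + a ^ 2) ^ (-(β - γ) / 2)) := by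
  have h4c : 0 < 4 * c := by positivity
  calc (1 + b ^ 2) ^ (-β / 2) ≤ c ^ (-β) := rpow_neg_half_le_of_sq_le hc (hγ.trans hγβ) hb
    _ = 4 ^ β * (4 * c) ^ (-β) := by
      rw [Real.mul_rpow zero_le_four hc.le, ← mul_assoc, ← Real.rpow_add four_pos]
      simp
    _ = 4 ^ β * ((4 * c) ^ (-γ) * (4 * c) ^ (-(β - γ))) := by
      rw [← Real.rpow_add h4c]
      ring_nf
    _ ≤ 4 ^ β * (M ^ (-γ) * (1 + a ^ 2) ^ (-(β - γ) / 2)) := by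
      refine mul_le_mul_of_nonneg_left (mul_le_mul ?_ ?_ (by positivity) (by positivity))
        (by positivity)
      · exact Real.rpow_le_rpow_of_nonpos hM hMc (by linarith)
      · exact rpow_neg_le_rpow_neg_half h4c.le (by positivity) (by linarith) ha

theorem stmt19 (n : ℕ) (α₁ β₁ γ₁ : ℝ) (hα : 0 ≤ α₁) (hγ : 0 ≤ γ₁) (hγβ : γ₁ ≤ β₁) :
    ∃ C : ℝ, 0 < C ∧
      ∀ (lk lj : ℝ) (ξk ξj : EuclideanSpace ℝ (Fin n)), 0 < lk → lk ≤ lj →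
        2 ≤ Rkj n lk lj ξk ξj →
        ∀ x : EuclideanSpace ℝ (Fin n),
          (lj * ‖x - ξj‖ ≤ Real.sqrt (lj / lk) * Rkj n lk lj ξk ξj / 2 →
            (1 + lk ^ 2 * ‖x - ξk‖ ^ 2) ^ (-α₁ / 2) *
                (1 + lj ^ 2 * ‖x - ξj‖ ^ 2) ^ (-β₁ / 2) ≤
              C * Rkj n lk lj ξk ξj ^ (-α₁) * (lj / lk) ^ (α₁ / 2) *
                (1 + lj ^ 2 * ‖x - ξj‖ ^ 2) ^ (-β₁ / 2)) ∧
          (Real.sqrt (lj / lk) * Rkj n lk lj ξk ξj / 2 ≤ lj * ‖x - ξj‖ →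
            (1 + lk ^ 2 * ‖x - ξk‖ ^ 2) ^ (-α₁ / 2) *
                (1 + lj ^ 2 * ‖x - ξj‖ ^ 2) ^ (-β₁ / 2) ≤
              C * Rkj n lk lj ξk ξj ^ (-γ₁) * (lj / lk) ^ (β₁ - γ₁ / 2) *
                (1 + lk ^ 2 * ‖x - ξk‖ ^ 2) ^ (-(α₁ + β₁ - γ₁) / 2)) := by
  have h2 : (1 : ℝ) ≤ 2 ^ α₁ := Real.one_le_rpow one_le_two hα
  have h4 : (1 : ℝ) ≤ 4 ^ β₁ := Real.one_le_rpow (by norm_num) (hγ.trans hγβ)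
  refine ⟨2 ^ α₁ * 4 ^ β₁, by positivity, ?_⟩
  intro lk lj ξk ξj hk hkj _ x
  have hj : 0 < lj := hk.trans_le hkj
  rw [Rkj_eq_sqrt_mul_max hk hj]
  set M := max 1 (lk * ‖ξk - ξj‖) with hMdef
  have hM1 : 1 ≤ M := le_max_left _ _
  have hMd : lk * ‖ξk - ξj‖ ≤ M := le_max_right _ _
  have hM : 0 < M := one_pos.trans_le hM1
  have hlj : lj = lj / lk * lk := by field_simp
  have hr1 : 1 ≤ lj / lk := (one_le_div hk).2 hkj
  set r := lj / lk
  have hr : 0 < r := one_pos.trans_le hr1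
  rw [← mul_assoc (√r), Real.mul_self_sqrt hr.le, mul_div_assoc, sqrt_mul_rpow_neg hr.le hM.le,
    sqrt_mul_rpow_neg hr.le hM.le, ← mul_pow, ← mul_pow]
  have hb : lj * ‖x - ξj‖ = r * (lk * ‖x - ξj‖) := by rw [← mul_assoc, ← hlj]
  have hA : 0 < 1 + (lk * ‖x - ξk‖) ^ 2 := by positivity
  have hB : 0 < 1 + (lj * ‖x - ξj‖) ^ 2 := by positivity
  have ha0 : 0 ≤ lk * ‖x - ξk‖ := by positivity
  constructor
  · intro h
    rw [hb, mul_le_mul_iff_right₀ hr] at h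
    have htri : lk * ‖ξk - ξj‖ ≤ lk * ‖x - ξk‖ + lk * ‖x - ξj‖ := by
      rw [← mul_add, norm_sub_rev x ξk]
      gcongr
      exact norm_sub_le_norm_sub_add_norm_sub _ _ _
    have hMa : (M / 2) ^ 2 ≤ 1 + (lk * ‖x - ξk‖) ^ 2 := by
      rcases max_choice 1 (lk * ‖ξk - ξj‖) with hm | hm <;> rw [← hMdef] at hm
      · rw [hm]
        nlinarith
      · nlinarith
    gcongr
    calc (1 + (lk * ‖x - ξk‖) ^ 2) ^ (-α₁ / 2) ≤ 2 ^ α₁ * M ^ (-α₁) :=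
          weight_le_of_half_le hα hM hMa
      _ ≤ 2 ^ α₁ * 4 ^ β₁ * M ^ (-α₁) := by
        gcongr
        exact le_mul_of_one_le_right (by positivity) h4
      _ = 2 ^ α₁ * 4 ^ β₁ * (r ^ (-α₁ / 2) * M ^ (-α₁)) * r ^ (α₁ / 2) := by
        have : r ^ (-α₁ / 2) * r ^ (α₁ / 2) = 1 := by
          rw [← Real.rpow_add hr, neg_div, neg_add_cancel, Real.rpow_zero]
        linear_combination (-(2 ^ α₁ * 4 ^ β₁ * M ^ (-α₁))) * this
  · intro h
    rw [hb, mul_le_mul_iff_right₀ hr] at h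
    have htri : lk * ‖x - ξk‖ ≤ lk * ‖x - ξj‖ + lk * ‖ξk - ξj‖ := by
      rw [← mul_add, norm_sub_rev ξk ξj]
      gcongr
      exact norm_sub_le_norm_sub_add_norm_sub _ _ _
    have hc : 0 < lk * ‖x - ξj‖ := by linarith
    have hcb : (lk * ‖x - ξj‖) ^ 2 ≤ 1 + (lj * ‖x - ξj‖) ^ 2 := by
      have : (lk * ‖x - ξj‖) ^ 2 ≤ (lj * ‖x - ξj‖) ^ 2 := by gcongr
      linarith
    have hac : 1 + (lk * ‖x - ξk‖) ^ 2 ≤ (4 * (lk * ‖x - ξj‖)) ^ 2 := by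
      have : lk * ‖x - ξk‖ ≤ 3 * (lk * ‖x - ξj‖) := by linarith
      nlinarith
    have key := weight_le_of_comparable hγ hγβ hM hc (by linarith) hac hcb
    have hrr : 1 ≤ r ^ (-γ₁ / 2) * r ^ (β₁ - γ₁ / 2) := by
      rw [← Real.rpow_add hr]
      exact Real.one_le_rpow hr1 (by linarith)
    have hconst : (4 : ℝ) ^ β₁ ≤
        2 ^ α₁ * 4 ^ β₁ * (r ^ (-γ₁ / 2) * r ^ (β₁ - γ₁ / 2)) :=
      (le_mul_of_one_le_left (by positivity) h2).trans
        (le_mul_of_one_le_right (by positivity) hrr)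
    rw [show -(α₁ + β₁ - γ₁) / 2 = -α₁ / 2 + -(β₁ - γ₁) / 2 by ring, Real.rpow_add hA]
    calc _ ≤ (1 + (lk * ‖x - ξk‖) ^ 2) ^ (-α₁ / 2) *
          (2 ^ α₁ * 4 ^ β₁ * (r ^ (-γ₁ / 2) * r ^ (β₁ - γ₁ / 2)) *
            (M ^ (-γ₁) * (1 + (lk * ‖x - ξk‖) ^ 2) ^ (-(β₁ - γ₁) / 2))) := by
          gcongr
          exact key.trans (by gcongr)
      _ = _ := by ring
end
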